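/- arXiv:1607.03901 — 2 statements merged into one kernel-verified Lean document; each statement's English description precedes it below -/
import Mathlib

section
/- Let M be a star-subalgebra of Matrix n n ℂ containing the identity which is a factor, and let p, q ∈ M be nonzero projections. Then there exists a nonzero partial isometry a ∈ M such that aᴴ * a and a * aᴴ are projections satisfying (aᴴ * a) * q = aᴴ * a and (a * aᴴ) * p = a * aᴴ (i.e. aᴴa ≤ q and aaᴴ ≤ p as projections). -/
open Matrix

/-- A projection is a matrix `p` with `pᴴ = p` and `p * p = p`. -/
def Matrix.IsProjection {n : Type*} [Fintype n] (p : Matrix n n ℂ) : Prop :=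
  pᴴ = p ∧ p * p = p

open Polynomial in
/-- The continuous functional calculus of a Hermitian element stays in the star-subalgebra. -/
lemma StarSubalgebra.cfc_mem_of_isHermitian {n : Type*} [Fintype n] [DecidableEq n]
    (M : StarSubalgebra ℂ (Matrix n n ℂ)) {h : Matrix n n ℂ} (hh : h.IsHermitian)
    (hM : h ∈ M) (f : ℝ → ℝ) : cfc f h ∈ M := by
  have hfin : (spectrum ℝ h).Finite := h.finite_real_spectrum
  let P : ℝ[X] := Lagrange.interpolate hfin.toFinset id f
  have hP : (spectrum ℝ h).EqOn f P.eval := fun x hx =>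
    (Lagrange.eval_interpolate_at_node f (v := id) (Set.injOn_id _)
      (hfin.mem_toFinset.mpr hx)).symm
  rw [cfc_congr hP, cfc_polynomial P h hh.isSelfAdjoint, aeval_eq_sum_range]
  refine sum_mem fun i _ => ?_
  rw [← Complex.coe_smul]
  exact M.smul_mem (pow_mem hM i) _

open scoped ComplexOrder in
/-- A star-subalgebra contains the square root of the pseudo-inverse of each of its positive
semidefinite elements. -/
lemma StarSubalgebra.exists_inv_sqrt {n : Type*} [Fintype n] [DecidableEq n]
    (M : StarSubalgebra ℂ (Matrix n n ℂ)) {h : Matrix n n ℂ} (hh : h.PosSemidef)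
    (hM : h ∈ M) :
    ∃ F ∈ M, Fᴴ = F ∧ F * h = h * F ∧ F * F * h * F = F ∧ h * (F * F) * h = h := by
  let f : ℝ → ℝ := fun x => (√x)⁻¹
  have hsa : IsSelfAdjoint h := hh.isHermitian
  have hcont (g : ℝ → ℝ) : ContinuousOn g (spectrum ℝ h) :=
    h.finite_real_spectrum.continuousOn g
  have hnonneg : ∀ x ∈ spectrum ℝ h, 0 ≤ x := by
    rw [hh.isHermitian.spectrum_real_eq_range_eigenvalues]
    rintro _ ⟨i, rfl⟩
    exact hh.eigenvalues_nonneg i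
  have hid : cfc (fun x : ℝ => x) h = h := cfc_id' ℝ h
  have hmul (g k : ℝ → ℝ) : cfc g h * cfc k h = cfc (fun x => g x * k x) h :=
    (cfc_mul g k h (hcont g) (hcont k)).symm
  have hcomm : cfc f h * h = h * cfc f h := by
    have hc : cfc f h * cfc (fun x : ℝ => x) h = cfc (fun x : ℝ => x) h * cfc f h := by
      simp only [hmul, mul_comm]
    rwa [hid] at hc
  have hpinv : cfc f h * cfc f h * cfc (fun x : ℝ => x) h * cfc f h = cfc f h := by
    rw [hmul, hmul, hmul]
    refine cfc_congr fun x hx => ?_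
    rcases (hnonneg x hx).eq_or_lt with rfl | hpos
    · simp [f]
    · have h0 : √x ≠ 0 := (Real.sqrt_pos.mpr hpos).ne'
      simp only [f]
      nth_rw 3 [← Real.mul_self_sqrt hpos.le]
      field_simp
  have hsupp : cfc (fun x : ℝ => x) h * (cfc f h * cfc f h) * cfc (fun x : ℝ => x) h =
      cfc (fun x : ℝ => x) h := by
    rw [hmul, hmul, hmul]
    refine cfc_congr fun x hx => ?_
    rcases (hnonneg x hx).eq_or_lt with rfl | hpos
    · simp
    · have h0 : √x ≠ 0 := (Real.sqrt_pos.mpr hpos).ne'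
      simp only [f]
      rw [← mul_inv, Real.mul_self_sqrt hpos.le, mul_inv_cancel₀ hpos.ne', one_mul]
  rw [hid] at hpinv hsupp
  exact ⟨cfc f h, M.cfc_mem_of_isHermitian hh.isHermitian hM f, cfc_predicate f h, hcomm,
    hpinv, hsupp⟩

open scoped ComplexOrder in
/-- A nonzero element `b` of a star-subalgebra becomes a nonzero partial isometry on right
multiplication by an element of the subalgebra commuting with `bᴴ * b`. -/
lemma StarSubalgebra.exists_partialIsometry {n : Type*} [Fintype n] [DecidableEq n]
    (M : StarSubalgebra ℂ (Matrix n n ℂ)) {b : Matrix n n ℂ} (hb : b ∈ M) (hb0 : b ≠ 0) :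
    ∃ F ∈ M, b * F ≠ 0 ∧ Matrix.IsProjection ((b * F)ᴴ * (b * F)) ∧
      Matrix.IsProjection ((b * F) * (b * F)ᴴ) ∧ F * (bᴴ * b) = bᴴ * b * F := by
  obtain ⟨F, hFM, hF, hcomm, hFF, hh⟩ :=
    M.exists_inv_sqrt (h := bᴴ * b) (posSemidef_conjTranspose_mul_self b)
      (mul_mem (star_mem hb) hb)
  have key : (b * F) * ((b * F)ᴴ * (b * F)) = b * F := by
    calc (b * F) * ((b * F)ᴴ * (b * F)) = b * (F * F * (bᴴ * b) * F) := by
          rw [conjTranspose_mul, hF]; simp only [Matrix.mul_assoc]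
      _ = b * F := by rw [hFF]
  refine ⟨F, hFM, ?_, ⟨by simp, ?_⟩, ⟨by simp, ?_⟩, hcomm⟩
  · intro h0
    apply hb0
    rw [← conjTranspose_mul_self_eq_zero, ← hh]
    calc bᴴ * b * (F * F) * (bᴴ * b) = bᴴ * (b * F) * F * (bᴴ * b) := by
          simp only [Matrix.mul_assoc]
      _ = 0 := by simp [h0]
  · rw [Matrix.mul_assoc, key]
  · rw [← Matrix.mul_assoc, Matrix.mul_assoc (b * F), key]

open scoped ComplexOrder in
/-- A star-subalgebra has a finite spanning family for which left multiplication and adjoint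
right multiplication have transposed coefficients. -/
lemma StarSubalgebra.exists_casimir_basis {n : Type*} [Fintype n] [DecidableEq n]
    (M : StarSubalgebra ℂ (Matrix n n ℂ)) :
    ∃ (m : ℕ) (b : Fin m → Matrix n n ℂ) (c : Matrix n n ℂ → Fin m → Fin m → ℂ),
      (∀ i, b i ∈ M) ∧ 1 ∈ Submodule.span ℂ (Set.range b) ∧
      (∀ x ∈ M, ∀ i, x * b i = ∑ j, c x i j • b j) ∧
      ∀ x ∈ M, ∀ i, (b i)ᴴ * x = ∑ j, c x j i • (b j)ᴴ := by
  let hpos : (1 : Matrix n n ℂ).PosDef := Matrix.PosDef.one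
  let _ := Matrix.toMatrixNormedAddCommGroup (1 : Matrix n n ℂ) hpos
  let _ := Matrix.toMatrixInnerProductSpace (1 : Matrix n n ℂ) hpos.posSemidef
  let S : Submodule ℂ (Matrix n n ℂ) := Subalgebra.toSubmodule M.toSubalgebra
  let b := stdOrthonormalBasis ℂ S
  have hin (x y : Matrix n n ℂ) : inner ℂ x y = (y * xᴴ).trace := by
    change (y * 1 * xᴴ).trace = _
    rw [Matrix.mul_one]
  have hexp (y : Matrix n n ℂ) (hy : y ∈ M) :
      y = ∑ j, (y * (b j : Matrix n n ℂ)ᴴ).trace • (b j : Matrix n n ℂ) := by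
    have h := congrArg Subtype.val (b.sum_repr' ⟨y, hy⟩)
    simp only [Submodule.coe_sum, Submodule.coe_smul, Submodule.coe_inner, hin] at h
    exact h.symm
  have hbM i : (b i : Matrix n n ℂ) ∈ M := (b i).2
  refine ⟨_, fun i => (b i : Matrix n n ℂ),
    fun x i j => (x * (b i : Matrix n n ℂ) * (b j : Matrix n n ℂ)ᴴ).trace,
    hbM, ?_, fun x hx i => hexp _ (mul_mem hx (hbM i)), fun x hx i => ?_⟩
  · rw [hexp 1 (one_mem M)]
    exact sum_mem fun j _ => Submodule.smul_mem _ _ (Submodule.subset_span ⟨j, rfl⟩)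
  · have h := congrArg conjTranspose (hexp (xᴴ * b i) (mul_mem (star_mem hx) (hbM i)))
    rw [conjTranspose_mul, conjTranspose_conjTranspose, conjTranspose_sum] at h
    refine h.trans (Finset.sum_congr rfl fun j _ => ?_)
    rw [conjTranspose_smul, ← trace_conjTranspose, conjTranspose_mul, conjTranspose_mul,
      conjTranspose_conjTranspose, conjTranspose_conjTranspose, Matrix.trace_mul_comm,
      Matrix.mul_assoc, Matrix.trace_mul_comm]

/-- In a factor, `p M q ≠ 0` for `p ≠ 0` and a nonzero projection `q ∈ M`. -/
lemma StarSubalgebra.exists_mul_mul_ne_zero_of_factor {n : Type*} [Fintype n] [DecidableEq n]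
    (M : StarSubalgebra ℂ (Matrix n n ℂ))
    (hfactor : ∀ z ∈ M, (∀ x ∈ M, z * x = x * z) → ∃ c : ℂ, z = c • (1 : Matrix n n ℂ))
    {p q : Matrix n n ℂ} (hqM : q ∈ M) (hq : Matrix.IsProjection q) (hp0 : p ≠ 0)
    (hq0 : q ≠ 0) : ∃ x ∈ M, p * x * q ≠ 0 := by
  by_contra! hzero
  obtain ⟨m, b, c, hbM, hone, hl, hr⟩ := M.exists_casimir_basis
  let T := ∑ i, b i * q * (b i)ᴴ
  have hTM : T ∈ M := sum_mem fun i _ => mul_mem (mul_mem (hbM i) hqM) (star_mem (hbM i))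
  have hT : ∀ x ∈ M, T * x = x * T := fun x hx => by
    simp only [T, Finset.sum_mul, Finset.mul_sum]
    have h1 i : b i * q * (b i)ᴴ * x = ∑ j, c x j i • (b i * q * (b j)ᴴ) := by
      rw [Matrix.mul_assoc, hr x hx, Finset.mul_sum]
      simp
    have h2 i : x * (b i * q * (b i)ᴴ) = ∑ j, c x i j • (b j * q * (b i)ᴴ) := by
      rw [← Matrix.mul_assoc, ← Matrix.mul_assoc, hl x hx, Finset.sum_mul, Finset.sum_mul]
      simp
    simp only [h1, h2]
    exact Finset.sum_comm
  obtain ⟨d, hd⟩ := hfactor T hTM hT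
  have hpT : p * T = 0 := by
    simp only [T, Finset.mul_sum]
    refine Finset.sum_eq_zero fun i _ => ?_
    rw [← Matrix.mul_assoc, ← Matrix.mul_assoc, hzero _ (hbM i), Matrix.zero_mul]
  have hT0 : T = 0 := by
    have : d • p = 0 := by simpa [hd] using hpT
    rw [hd, (smul_eq_zero.mp this).resolve_right hp0, zero_smul]
  have hterm i : b i * q * (b i)ᴴ = (b i * q) * (b i * q)ᴴ := by
    rw [conjTranspose_mul, hq.1, ← Matrix.mul_assoc, Matrix.mul_assoc (b i) q q, hq.2]
  have hbq i : b i * q = 0 := by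
    have htr : ∑ i, ((b i * q) * (b i * q)ᴴ).trace = 0 := by
      rw [← Matrix.trace_sum, ← Finset.sum_congr rfl fun i _ => hterm i]
      change T.trace = 0
      rw [hT0, Matrix.trace_zero]
    open scoped ComplexOrder in
    exact trace_mul_conjTranspose_self_eq_zero_iff.mp ((Finset.sum_eq_zero_iff_of_nonneg
      fun i _ => (posSemidef_self_mul_conjTranspose _).trace_nonneg).mp htr i
        (Finset.mem_univ i))
  have hker : Submodule.span ℂ (Set.range b) ≤
      LinearMap.ker (LinearMap.mulRight ℂ q) := by
    rw [Submodule.span_le]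
    rintro _ ⟨i, rfl⟩
    exact hbq i
  exact hq0 (by simpa using hker hone)

/-- If `M` is a von Neumann algebra on `ℂ^n` (a star-subalgebra of `Matrix n n ℂ`) which
is a factor, and `p, q ∈ M` are nonzero projections, then there is a nonzero partial
isometry `a ∈ M` with `aᴴ * a ≤ q` and `a * aᴴ ≤ p` (where for projections `r ≤ s` means
`r * s = r`). -/
theorem factor_partial_isometry_between_projections {n : Type*} [Fintype n] [DecidableEq n]
    [Nonempty n] (M : StarSubalgebra ℂ (Matrix n n ℂ))
    (hfactor : ∀ z ∈ M, (∀ x ∈ M, z * x = x * z) → ∃ c : ℂ, z = c • (1 : Matrix n n ℂ))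
    (p q : Matrix n n ℂ) (hpM : p ∈ M) (hqM : q ∈ M)
    (hp : Matrix.IsProjection p) (hq : Matrix.IsProjection q)
    (hp0 : p ≠ 0) (hq0 : q ≠ 0) :
    ∃ a : Matrix n n ℂ, a ∈ M ∧ a ≠ 0 ∧
      Matrix.IsProjection (aᴴ * a) ∧ Matrix.IsProjection (a * aᴴ) ∧
      (aᴴ * a) * q = aᴴ * a ∧ (a * aᴴ) * p = a * aᴴ := by
  obtain ⟨x, hxM, hx⟩ := M.exists_mul_mul_ne_zero_of_factor hfactor hqM hq hp0 hq0
  obtain ⟨F, hFM, ha0, hinit, hfinal, hcomm⟩ :=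
    M.exists_partialIsometry (mul_mem (mul_mem hpM hxM) hqM) hx
  have hF : p * x * q * F ∈ M := mul_mem (mul_mem (mul_mem hpM hxM) hqM) hFM
  refine ⟨p * x * q * F, hF, ha0, hinit, hfinal, ?_, ?_⟩
  · have hbq : (p * x * q)ᴴ * (p * x * q) * q = (p * x * q)ᴴ * (p * x * q) := by
      simp only [Matrix.mul_assoc, hq.2]
    have hinit_eq : (p * x * q * F)ᴴ * (p * x * q * F) =
        Fᴴ * F * ((p * x * q)ᴴ * (p * x * q)) := by
      rw [Matrix.mul_assoc Fᴴ, hcomm, conjTranspose_mul]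
      simp only [Matrix.mul_assoc]
    rw [hinit_eq, Matrix.mul_assoc, hbq]
  · rw [conjTranspose_mul, conjTranspose_mul, conjTranspose_mul, hp.1]
    simp only [Matrix.mul_assoc, hp.2]
end

section
/- (Subsystem erasure-correction conditions.) The following are equivalent: (2) for every o : Matrix (Fin k) (Fin k) ℂ there exists O_A : Matrix A A ℂ such that for all i, j, (O_A ⊗ₖ 1).mulVec (v (i,j)) = Σ_{i'} (o i' i) • v (i', j) and (O_A ⊗ₖ 1)ᴴ.mulVec (v (i,j)) = Σ_{i'} (conj (o i i')) • v (i', j) (every logical operator on the first tensor factor of the code subspace, and its adjoint, is represented by an operator supported on A); (3) for every X : Matrix Ā Ā ℂ there exists x̄ : Matrix (Fin l) (Fin l) ℂ such that P * (1 ⊗ₖ X) * P = Σ_{i, j, j'} (x̄ j j') • E (i,j) (i,j'), where E (i,j) (i,j') is the matrix with entries E z z' = v (i,j) z * conj (v (i,j') z') (i.e. P X_Ā P acts within the code subspace as the identity on the first logical factor tensored with some operator on the second logical factor). -/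
open Matrix Kronecker

/-- The projection onto the subsystem code subspace spanned by the family `v`:
`P z z' = Σ_{i,j} v (i,j) z * conj (v (i,j) z')`. -/
noncomputable def codeProj2 {A B : Type*} [Fintype A] [Fintype B] {k l : ℕ}
    (v : Fin k × Fin l → A × B → ℂ) : Matrix (A × B) (A × B) ℂ :=
  Matrix.of fun z z' => ∑ i, ∑ j, v (i, j) z * (starRingEnd ℂ) (v (i, j) z')

namespace Matrix

/-- Every square matrix over a field has a generalized inverse. -/
theorem exists_mul_mul_eq_self {n K : Type*} [Fintype n] [DecidableEq n] [Field K]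
    (R : Matrix n n K) : ∃ S : Matrix n n K, R * S * R = R := by
  obtain ⟨g, hg⟩ := (toLin' R).rangeRestrict.exists_rightInverse_of_surjective
    (LinearMap.range_rangeRestrict _)
  obtain ⟨f, hf⟩ := LinearMap.exists_extend g
  refine ⟨LinearMap.toMatrix' f, toLin'.injective ?_⟩
  rw [toLin'_mul, toLin'_mul, toLin'_toMatrix']
  ext1 x
  have h1 : f (toLin' R (Pi.single x 1)) = g ((toLin' R).rangeRestrict (Pi.single x 1)) :=
    LinearMap.congr_fun hf ((toLin' R).rangeRestrict (Pi.single x 1))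
  have h2 := congrArg Subtype.val
    (LinearMap.congr_fun hg ((toLin' R).rangeRestrict (Pi.single x 1)))
  ext1
  simp only [LinearMap.comp_apply, LinearMap.coe_single]
  rw [h1]
  exact h2

/-- A generalized inverse of the Gram matrix `Vᴴ * V` is absorbed by `V`. -/
theorem mul_mul_eq_self_of_gram {m n : Type*} [Fintype m] [Fintype n]
    {V : Matrix m n ℂ} {R S : Matrix n n ℂ} (hV : Vᴴ * V = R) (hS : R * S * R = R) :
    V * S * R = V := by
  open scoped ComplexOrder in
  rw [← sub_eq_zero, ← conjTranspose_mul_self_eq_zero]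
  have hR : Rᴴ = R := by rw [← hV, conjTranspose_mul, conjTranspose_conjTranspose]
  have h1 : R * (S * R) = R := by rw [← Matrix.mul_assoc, hS]
  have h2 (T : Matrix n n ℂ) : Vᴴ * (V * T) = R * T := by rw [← Matrix.mul_assoc, hV]
  simp only [conjTranspose_sub, conjTranspose_mul, Matrix.sub_mul, Matrix.mul_sub,
    Matrix.mul_assoc, h2, hV, hR, h1, sub_self]

/-- If the blocks `V i` have orthogonal ranges and a common Gram matrix, then every matrix `o` on
the block index is implemented, together with its adjoint, by left multiplication. -/
theorem exists_mul_eq_sum_smul_of_gram {ι m n : Type*} [Fintype ι] [DecidableEq ι] [Fintype m]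
    [Fintype n] [DecidableEq n] {V : ι → Matrix m n ℂ} {R : Matrix n n ℂ}
    (hV : ∀ i i', (V i)ᴴ * V i' = if i = i' then R else 0) (o : Matrix ι ι ℂ) :
    ∃ O : Matrix m m ℂ, ∀ i, O * V i = ∑ i', o i' i • V i' ∧
      Oᴴ * V i = ∑ i', (starRingEnd ℂ) (o i i') • V i' := by
  obtain ⟨S, hS⟩ := exists_mul_mul_eq_self R
  have hVR (i : ι) : (V i)ᴴ * V i = R := by simpa using hV i i
  have hSH (i : ι) : R * Sᴴ * R = R := by
    have hR : Rᴴ = R := by rw [← hVR i, conjTranspose_mul, conjTranspose_conjTranspose]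
    have h := congrArg conjTranspose hS
    simpa only [conjTranspose_mul, hR, Matrix.mul_assoc] using h
  have key {T : Matrix n n ℂ} (hT : R * T * R = R) (p q i : ι) :
      V p * T * (V q)ᴴ * V i = if q = i then V p else 0 := by
    rw [Matrix.mul_assoc, hV]
    split_ifs
    · exact mul_mul_eq_self_of_gram (hVR p) hT
    · exact Matrix.mul_zero _
  refine ⟨∑ p : ι, ∑ q : ι, o p q • (V p * S * (V q)ᴴ), fun i => ⟨?_, ?_⟩⟩
  · simp [Matrix.sum_mul, key hS]
  · simp only [conjTranspose_sum, conjTranspose_smul, conjTranspose_mul,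
      conjTranspose_conjTranspose, ← Matrix.mul_assoc]
    rw [Finset.sum_comm]
    simp [Matrix.sum_mul, key (hSH i)]

/-- A matrix commuting with every `o ⊗ₖ 1` is of the form `1 ⊗ₖ x`. -/
theorem exists_eq_one_kronecker_of_commute {ι κ R : Type*} [Fintype ι] [DecidableEq ι] [Nonempty ι]
    [Fintype κ] [DecidableEq κ] [CommSemiring R] {G : Matrix (ι × κ) (ι × κ) R}
    (hG : ∀ o : Matrix ι ι R, Commute G (o ⊗ₖ (1 : Matrix κ κ R))) :
    ∃ x : Matrix κ κ R, G = (1 : Matrix ι ι R) ⊗ₖ x := by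
  obtain ⟨c⟩ := ‹Nonempty ι›
  refine ⟨of fun j j' => G (c, j) (c, j'), ?_⟩
  ext ⟨i, j⟩ ⟨i', j'⟩
  have h := congrFun (congrFun (hG (single i' c 1)).eq (i, j)) (c, j')
  simpa [mul_apply, kroneckerMap_apply, Fintype.sum_prod_type, single_apply, one_apply, ite_and,
    eq_comm] using h

end Matrix

/-- The isometry onto the code subspace, with columns the vectors `v p`. -/
def codeIsometry {A B : Type*} {k l : ℕ} (v : Fin k × Fin l → A × B → ℂ) :
    Matrix (A × B) (Fin k × Fin l) ℂ :=
  Matrix.of fun z p => v p z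

theorem sum_smul_eq_codeIsometry_mul {A B : Type*} {k l : ℕ}
    (v : Fin k × Fin l → A × B → ℂ) (x : Matrix (Fin l) (Fin l) ℂ) :
    (∑ i, ∑ j, ∑ j', x j j' •
      (Matrix.of fun z z' => v (i, j) z * (starRingEnd ℂ) (v (i, j') z'))) =
      codeIsometry v * ((1 : Matrix (Fin k) (Fin k) ℂ) ⊗ₖ x) * (codeIsometry v)ᴴ := by
  ext z z'
  simp only [codeIsometry, mul_apply, Matrix.sum_apply, Matrix.smul_apply, of_apply,
    Fintype.sum_prod_type, kroneckerMap_apply, one_apply, conjTranspose_apply, ite_mul, one_mul,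
    zero_mul, mul_ite, mul_zero, Finset.sum_mul, smul_eq_mul]
  refine Finset.sum_congr rfl fun i _ => ?_
  rw [Finset.sum_comm]
  simp [mul_comm, mul_assoc]

section codeIsometry

variable {A B : Type*} [Fintype A] [Fintype B] {k l : ℕ}
  (v : Fin k × Fin l → A × B → ℂ)

theorem codeProj2_eq : codeProj2 v = codeIsometry v * (codeIsometry v)ᴴ := by
  ext z z'
  simp [codeProj2, codeIsometry, mul_apply, Fintype.sum_prod_type]

theorem codeIsometry_conjTranspose_mul_self
    (hv : ∀ p q, (∑ z, (starRingEnd ℂ) (v p z) * v q z) = if p = q then 1 else 0) :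
    (codeIsometry v)ᴴ * codeIsometry v = 1 := by
  ext p q
  simpa [codeIsometry, mul_apply, one_apply] using hv p q

theorem mul_codeIsometry_eq_iff (K : Matrix (A × B) (A × B) ℂ) (o : Matrix (Fin k) (Fin k) ℂ) :
    K * codeIsometry v = codeIsometry v * (o ⊗ₖ (1 : Matrix (Fin l) (Fin l) ℂ)) ↔
      ∀ i j, K.mulVec (v (i, j)) = ∑ i', o i' i • v (i', j) := by
  simp only [← Matrix.ext_iff, Prod.forall, funext_iff]
  have h (a : A) (b : B) (i : Fin k) (j : Fin l) :
      (codeIsometry v * (o ⊗ₖ (1 : Matrix (Fin l) (Fin l) ℂ))) (a, b) (i, j) =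
        (∑ i', o i' i • v (i', j)) (a, b) := by
    simp [codeIsometry, mul_apply, Fintype.sum_prod_type, one_apply, mul_comm]
  simp only [h]
  exact ⟨fun H i j a b => H a b i j, fun H a b i j => H i j a b⟩

/-- Compressing to the code subspace is the same as conjugating by the isometry. -/
theorem codeProj2_compress_eq_iff
    (hv : ∀ p q, (∑ z, (starRingEnd ℂ) (v p z) * v q z) = if p = q then 1 else 0)
    (K : Matrix (A × B) (A × B) ℂ) (x : Matrix (Fin l) (Fin l) ℂ) :
    (codeProj2 v * K * codeProj2 v = ∑ i, ∑ j, ∑ j', x j j' •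
      (Matrix.of fun z z' => v (i, j) z * (starRingEnd ℂ) (v (i, j') z'))) ↔
      (codeIsometry v)ᴴ * K * codeIsometry v = (1 : Matrix (Fin k) (Fin k) ℂ) ⊗ₖ x := by
  rw [codeProj2_eq, sum_smul_eq_codeIsometry_mul]
  have hW := codeIsometry_conjTranspose_mul_self v hv
  set W := codeIsometry v
  constructor
  · intro h
    calc Wᴴ * K * W = (Wᴴ * W) * Wᴴ * K * W * (Wᴴ * W) := by rw [hW]; simp
      _ = Wᴴ * (W * Wᴴ * K * (W * Wᴴ)) * W := by simp only [Matrix.mul_assoc]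
      _ = (Wᴴ * W) * ((1 : Matrix (Fin k) (Fin k) ℂ) ⊗ₖ x) * (Wᴴ * W) := by
        rw [h]; simp only [Matrix.mul_assoc]
      _ = _ := by rw [hW]; simp
  · intro h
    rw [← h]
    simp only [Matrix.mul_assoc]

end codeIsometry

/-- **Subsystem erasure-correction conditions**: for a code subspace of `ℂ^(A × Ā)` that
factorizes into logical subsystems, spanned by an orthonormal family
`v : Fin k × Fin l → ℂ^(A × Ā)` with code projection `P`, the following are equivalent:
(2) every logical operator `o` on the first tensor factor, and its adjoint, is represented
by an operator `O_A` supported on `A`;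
(3) for every `X` supported on `Ā`, `P * X * P` acts within the code subspace as the
identity on the first logical factor tensored with some operator `x̄` on the second. -/
theorem subsystem_erasure_correction_conditions {A B : Type*}
    [Fintype A] [DecidableEq A] [Nonempty A] [Fintype B] [DecidableEq B] [Nonempty B]
    {k l : ℕ} (hk : 0 < k) (hl : 0 < l) (v : Fin k × Fin l → A × B → ℂ)
    (hv : ∀ p q, (∑ z, (starRingEnd ℂ) (v p z) * v q z) = if p = q then 1 else 0) :
    (∀ o : Matrix (Fin k) (Fin k) ℂ, ∃ OA : Matrix A A ℂ, ∀ i j,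
      ((OA ⊗ₖ (1 : Matrix B B ℂ)).mulVec (v (i, j)) = ∑ i', o i' i • v (i', j)) ∧
      ((OA ⊗ₖ (1 : Matrix B B ℂ))ᴴ.mulVec (v (i, j)) =
        ∑ i', (starRingEnd ℂ) (o i i') • v (i', j)))
    ↔
    (∀ X : Matrix B B ℂ, ∃ xb : Matrix (Fin l) (Fin l) ℂ,
      codeProj2 v * ((1 : Matrix A A ℂ) ⊗ₖ X) * codeProj2 v =
        ∑ i, ∑ j, ∑ j', xb j j' •
          (Matrix.of fun z z' => v (i, j) z * (starRingEnd ℂ) (v (i, j') z'))) := by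
  constructor
  · intro H X
    have : Nonempty (Fin k) := ⟨⟨0, hk⟩⟩
    simp only [codeProj2_compress_eq_iff v hv]
    refine exists_eq_one_kronecker_of_commute fun o => ?_
    obtain ⟨OA, hO⟩ := H o
    have h1 := (mul_codeIsometry_eq_iff v _ o).2 fun i j => (hO i j).1
    have h2 := (mul_codeIsometry_eq_iff v _ oᴴ).2 fun i j => (hO i j).2
    have h3 := congrArg conjTranspose h2
    simp only [conjTranspose_mul, conjTranspose_conjTranspose, conjTranspose_kronecker,
      conjTranspose_one] at h3
    have hc : ((1 : Matrix A A ℂ) ⊗ₖ X) * (OA ⊗ₖ (1 : Matrix B B ℂ)) =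
        (OA ⊗ₖ (1 : Matrix B B ℂ)) * ((1 : Matrix A A ℂ) ⊗ₖ X) := by
      simp [← mul_kronecker_mul]
    rw [commute_iff_eq, Matrix.mul_assoc, ← h1, ← Matrix.mul_assoc, Matrix.mul_assoc _ _ (OA ⊗ₖ _),
      hc, ← Matrix.mul_assoc, h3]
    simp only [Matrix.mul_assoc]
  · intro H o
    simp only [codeProj2_compress_eq_iff v hv] at H
    choose x hx using H
    have hV (i i' : Fin k) :
        (Matrix.of fun (a : A) (p : Fin l × B) => v (i, p.1) (a, p.2))ᴴ *
          (Matrix.of fun (a : A) (p : Fin l × B) => v (i', p.1) (a, p.2)) =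
        if i = i' then Matrix.of fun p q : Fin l × B => x (single p.2 q.2 1) p.1 q.1 else 0 := by
      ext ⟨j, b⟩ ⟨j', b'⟩
      have h := congrFun (congrFun (hx (single b b' 1)) (i, j)) (i', j')
      simp only [codeIsometry, mul_apply, Fintype.sum_prod_type, kroneckerMap_apply, one_apply,
        single_apply, conjTranspose_apply, of_apply] at h
      simp only [mul_apply, conjTranspose_apply, of_apply]
      trans if i = i' then x (single b b' 1) j j' else 0
      · simpa [ite_and] using h
      · split_ifs <;> simp
    obtain ⟨O, hO⟩ := exists_mul_eq_sum_smul_of_gram hV o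
    have hmul (K : Matrix A A ℂ) (w : A × B → ℂ) (a : A) (b : B) :
        (K ⊗ₖ (1 : Matrix B B ℂ)).mulVec w (a, b) = ∑ a', K a a' * w (a', b) := by
      simp [mulVec, dotProduct, Fintype.sum_prod_type, one_apply]
    refine ⟨O, fun i j => ⟨?_, ?_⟩⟩
    · ext ⟨a, b⟩
      have h := congrFun (congrFun (hO i).1 a) (j, b)
      rw [hmul]
      simpa [mul_apply, Matrix.sum_apply] using h
    · ext ⟨a, b⟩
      have h := congrFun (congrFun (hO i).2 a) (j, b)
      rw [conjTranspose_kronecker, conjTranspose_one, hmul]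
      simpa [mul_apply, Matrix.sum_apply] using h
end
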